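/- Let G be a finite soluble PT-group (every subnormal subgroup is quasinormal) and p a prime. If every submodular p-subgroup of G is modular in G, then every p-subgroup of G is modular in G. -/

import Mathlib

open Subgroup
open scoped Pointwise

section Defs

variable {ι : Type*}

/-- `σ` is a partition of the set of all primes. -/
structure IsPrimePartition (σ : ι → Set ℕ) : Prop where
  prime_of_mem : ∀ i p, p ∈ σ i → p.Prime
  existsUnique_mem : ∀ p : ℕ, p.Prime → ∃! i, p ∈ σ i

/-- every prime dividing `n` lies in the block `σ i`. -/
def IsSigmaNumber (σ : ι → Set ℕ) (i : ι) (n : ℕ) : Prop :=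
  ∀ p : ℕ, p.Prime → p ∣ n → p ∈ σ i

/-- `G` is a `σ i`-group. -/
def IsSigmaIGroup (σ : ι → Set ℕ) (i : ι) (G : Type*) [Group G] : Prop :=
  IsSigmaNumber σ i (Nat.card G)

/-- `G` is σ-primary: it is a `σ i`-group for some `i`. -/
def IsSigmaPrimary (σ : ι → Set ℕ) (G : Type*) [Group G] : Prop :=
  ∃ i, IsSigmaIGroup σ i G

/-- `G` is σ-nilpotent: `G` is the internal direct product of normal
σ-primary subgroups (one `σ i`-subgroup for each block). -/
def IsSigmaNilpotent (σ : ι → Set ℕ) (G : Type*) [Group G] : Prop :=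
  ∃ H : ι → Subgroup G, (∀ i, (H i).Normal) ∧ (∀ i, IsSigmaIGroup σ i ↥(H i)) ∧
    iSupIndep H ∧ iSup H = ⊤

/-- One step in a σ-subnormal chain: `A ≤ B` and either `A` is normal in `B` or
`B/(A_B)` (quotient by the normal core of `A` in `B`) is σ-primary. -/
def SigmaSubnormalStep (σ : ι → Set ℕ) {G : Type*} [Group G] (A B : Subgroup G) : Prop :=
  A ≤ B ∧ (((A.subgroupOf B).Normal) ∨
    IsSigmaPrimary σ (↥B ⧸ (A.subgroupOf B).normalCore))

/-- `A` is σ-subnormal in `G`. -/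
def IsSigmaSubnormal (σ : ι → Set ℕ) {G : Type*} [Group G] (A : Subgroup G) : Prop :=
  ∃ n, ∃ C : Fin (n + 1) → Subgroup G, C 0 = A ∧ C (Fin.last n) = ⊤ ∧
    ∀ k : Fin n, SigmaSubnormalStep σ (C k.castSucc) (C k.succ)

/-- `A` is subnormal in `G`. -/
def IsSubnormalSub {G : Type*} [Group G] (A : Subgroup G) : Prop :=
  ∃ n, ∃ C : Fin (n + 1) → Subgroup G, C 0 = A ∧ C (Fin.last n) = ⊤ ∧
    ∀ k : Fin n, C k.castSucc ≤ C k.succ ∧ ((C k.castSucc).subgroupOf (C k.succ)).Normal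

/-- `M` is a modular subgroup of `G`: a modular element of the subgroup lattice. -/
def IsModularSubgroup {G : Type*} [Group G] (M : Subgroup G) : Prop :=
  (∀ X Z : Subgroup G, X ≤ Z → X ⊔ (M ⊓ Z) = (X ⊔ M) ⊓ Z) ∧
  (∀ Y Z : Subgroup G, M ≤ Z → M ⊔ (Y ⊓ Z) = (M ⊔ Y) ⊓ Z)

/-- `A` is submodular in `G`: there is a chain from `A` to `G` with each
term modular in the next. -/
def IsSubmodular {G : Type*} [Group G] (A : Subgroup G) : Prop :=
  ∃ n, ∃ C : Fin (n + 1) → Subgroup G, C 0 = A ∧ C (Fin.last n) = ⊤ ∧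
    ∀ k : Fin n, C k.castSucc ≤ C k.succ ∧
      IsModularSubgroup ((C k.castSucc).subgroupOf (C k.succ))

/-- `H` is a Hall `σ i`-subgroup of `G`. -/
def IsHallSigmaI (σ : ι → Set ℕ) (i : ι) {G : Type*} [Group G] (H : Subgroup G) : Prop :=
  IsSigmaNumber σ i (Nat.card H) ∧ ∀ p : ℕ, p.Prime → p ∣ H.index → p ∉ σ i

/-- `G` is σ-full: it has a Hall `σ i`-subgroup for every `σ i ∈ σ(G)`. -/
def IsSigmaFull (σ : ι → Set ℕ) (G : Type*) [Group G] : Prop :=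
  ∀ i, (∃ p : ℕ, p.Prime ∧ p ∈ σ i ∧ p ∣ Nat.card G) →
    ∃ H : Subgroup G, IsHallSigmaI σ i H

/-- Two subgroups permute. -/
def Permutes {G : Type*} [Group G] (A B : Subgroup G) : Prop :=
  (A : Set G) * (B : Set G) = (B : Set G) * (A : Set G)

/-- `A` is σ-permutable in `G`: it permutes with every Hall `σ i`-subgroup of `G`
(hence with all their conjugates). -/
def IsSigmaPermutable (σ : ι → Set ℕ) {G : Type*} [Group G] (A : Subgroup G) : Prop :=
  ∀ i, ∀ H : Subgroup G, IsHallSigmaI σ i H → Permutes A H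

/-- `A` is quasinormal (permutable) in `G`. -/
def IsQuasinormal {G : Type*} [Group G] (A : Subgroup G) : Prop :=
  ∀ B : Subgroup G, Permutes A B

/-- `A` is σ-quasinormal in `G`: modular and σ-subnormal. -/
def IsSigmaQuasinormal (σ : ι → Set ℕ) {G : Type*} [Group G] (A : Subgroup G) : Prop :=
  IsModularSubgroup A ∧ IsSigmaSubnormal σ A

/-- σ-permutability is a transitive relation on `G`. -/
def IsPSigmaTGroup (σ : ι → Set ℕ) (G : Type*) [Group G] : Prop :=
  ∀ K H : Subgroup G, H ≤ K → IsSigmaPermutable σ (H.subgroupOf K) →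
    IsSigmaPermutable σ K → IsSigmaPermutable σ H

/-- `H/K` is a chief factor of `G`. -/
def IsChiefFactor (G : Type*) [Group G] (K H : Subgroup G) : Prop :=
  K.Normal ∧ H.Normal ∧ K < H ∧
    ∀ N : Subgroup G, N.Normal → K ≤ N → N ≤ H → N = K ∨ N = H

/-- `G` is σ-soluble: every chief factor of `G` is σ-primary. -/
def IsSigmaSoluble (σ : ι → Set ℕ) (G : Type*) [Group G] : Prop :=
  ∀ K H : Subgroup G, ∀ hc : IsChiefFactor G K H,
    letI := hc.1; IsSigmaPrimary σ (↥H ⧸ K.subgroupOf H)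

/-- The σ-nilpotent residual `G^{𝔑_σ}` of `G`. -/
def sigmaNilpotentResidual (σ : ι → Set ℕ) (G : Type*) [Group G] : Subgroup G :=
  sInf {N : Subgroup G | ∃ h : N.Normal, letI := h; IsSigmaNilpotent σ (G ⧸ N)}

/-- The σ-soluble residual `G^{𝔖_σ}` of `G`. -/
def sigmaSolubleResidual (σ : ι → Set ℕ) (G : Type*) [Group G] : Subgroup G :=
  sInf {N : Subgroup G | ∃ h : N.Normal, letI := h; IsSigmaSoluble σ (G ⧸ N)}

/-- `G` is a σ-SC-group: every chief factor of `G` below `G^{𝔑_σ}` is simple. -/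
def IsSigmaSCGroup (σ : ι → Set ℕ) (G : Type*) [Group G] : Prop :=
  ∀ K H : Subgroup G, ∀ hc : IsChiefFactor G K H, H ≤ sigmaNilpotentResidual σ G →
    letI := hc.1; IsSimpleGroup (↥H ⧸ K.subgroupOf H)

/-- `G` is σ-supersoluble: every chief factor of `G` below `G^{𝔑_σ}` is cyclic. -/
def IsSigmaSupersoluble (σ : ι → Set ℕ) (G : Type*) [Group G] : Prop :=
  ∀ K H : Subgroup G, ∀ hc : IsChiefFactor G K H, H ≤ sigmaNilpotentResidual σ G →
    letI := hc.1; IsCyclic (↥H ⧸ K.subgroupOf H)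

/-- The σ-supersoluble residual `G^{𝔘_σ}` of `G`. -/
def sigmaSupersolubleResidual (σ : ι → Set ℕ) (G : Type*) [Group G] : Subgroup G :=
  sInf {N : Subgroup G | ∃ h : N.Normal, letI := h; IsSigmaSupersoluble σ (G ⧸ N)}

/-- The soluble radical `G_𝔖`: the largest soluble normal subgroup of `G`. -/
def solubleRadical (G : Type*) [Group G] : Subgroup G :=
  sSup {N : Subgroup G | N.Normal ∧ IsSolvable ↥N}

/-- `O_{σ i}(G)`: the largest normal `σ i`-subgroup of `G`. -/
def sigmaCore (σ : ι → Set ℕ) (i : ι) (G : Type*) [Group G] : Subgroup G :=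
  sSup {N : Subgroup G | N.Normal ∧ IsSigmaIGroup σ i ↥N}

/-- `O^{σ i}(G)`: the smallest normal subgroup of `G` with `σ i`-quotient. -/
def sigmaIResidual (σ : ι → Set ℕ) (i : ι) (G : Type*) [Group G] : Subgroup G :=
  sInf {N : Subgroup G | ∃ h : N.Normal, letI := h; IsSigmaIGroup σ i (G ⧸ N)}

end Defs


section Helpers

/-- Modularity of `A` inside `B`, phrased in the lattice of the ambient group. -/
def ModIn {G : Type*} [Group G] (A B : Subgroup G) : Prop :=
  (∀ X Z : Subgroup G, X ≤ Z → Z ≤ B → (X ⊔ A) ⊓ Z ≤ X ⊔ (A ⊓ Z)) ∧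
  (∀ Y Z : Subgroup G, Y ≤ B → Z ≤ B → A ≤ Z → (A ⊔ Y) ⊓ Z ≤ A ⊔ (Y ⊓ Z))

lemma modular_iff_modIn_top {G : Type*} [Group G] (A : Subgroup G) :
    IsModularSubgroup A ↔ ModIn A ⊤ := by
  constructor
  · rintro ⟨h1, h2⟩
    exact ⟨fun X Z h _ => (h1 X Z h).ge, fun Y Z _ _ h => (h2 Y Z h).ge⟩
  · rintro ⟨h1, h2⟩
    refine ⟨fun X Z h => le_antisymm ?_ (h1 X Z h le_top),
      fun Y Z h => le_antisymm ?_ (h2 Y Z le_top le_top h)⟩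
    · exact sup_le (le_inf le_sup_left h) (inf_le_inf_right _ le_sup_right)
    · exact sup_le (le_inf le_sup_left h) (inf_le_inf_right _ le_sup_right)

lemma ModIn.map {G H : Type*} [Group G] [Group H] {f : G →* H}
    (hf : Function.Injective f) {A B : Subgroup G} (h : ModIn A B) :
    ModIn (A.map f) (B.map f) := by
  have key : ∀ X : Subgroup H, X ≤ B.map f → ∃ X' : Subgroup G, X' ≤ B ∧ X = X'.map f := by
    intro X hX
    refine ⟨X.comap f, ?_, ?_⟩
    · calc X.comap f ≤ (B.map f).comap f := comap_mono hX
        _ = B := comap_map_eq_self_of_injective hf B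
    · rw [map_comap_eq, inf_eq_right.2]
      exact hX.trans (map_le_range f B)
  constructor
  · intro X Z hXZ hZ
    obtain ⟨X, hX', rfl⟩ := key X (hXZ.trans hZ)
    obtain ⟨Z, hZ', rfl⟩ := key Z hZ
    rw [← Subgroup.map_sup, ← Subgroup.map_inf _ _ _ hf, ← Subgroup.map_inf _ _ _ hf, ← Subgroup.map_sup]
    exact map_mono (h.1 X Z ((map_le_map_iff_of_injective hf).1 hXZ) hZ')
  · intro X Z hX hZ hAZ
    obtain ⟨X, hX', rfl⟩ := key X hX
    obtain ⟨Z, hZ', rfl⟩ := key Z hZ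
    rw [← Subgroup.map_sup, ← Subgroup.map_inf _ _ _ hf, ← Subgroup.map_inf _ _ _ hf, ← Subgroup.map_sup]
    exact map_mono (h.2 X Z hX' hZ' ((map_le_map_iff_of_injective hf).1 hAZ))

lemma ModIn.of_map {G H : Type*} [Group G] [Group H] {f : G →* H}
    (hf : Function.Injective f) {A B : Subgroup G} (h : ModIn (A.map f) (B.map f)) :
    ModIn A B := by
  constructor
  · intro X Z hXZ hZ
    have := h.1 (X.map f) (Z.map f) (map_mono hXZ) (map_mono hZ)
    rw [← Subgroup.map_sup, ← Subgroup.map_inf _ _ _ hf, ← Subgroup.map_inf _ _ _ hf, ← Subgroup.map_sup] at this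
    exact (map_le_map_iff_of_injective hf).1 this
  · intro X Z hX hZ hAZ
    have := h.2 (X.map f) (Z.map f) (map_mono hX) (map_mono hZ) (map_mono hAZ)
    rw [← Subgroup.map_sup, ← Subgroup.map_inf _ _ _ hf, ← Subgroup.map_inf _ _ _ hf, ← Subgroup.map_sup] at this
    exact (map_le_map_iff_of_injective hf).1 this

lemma modular_subgroupOf_iff {G : Type*} [Group G] {A B : Subgroup G} (hAB : A ≤ B) :
    IsModularSubgroup (A.subgroupOf B) ↔ ModIn A B := by
  rw [modular_iff_modIn_top]
  have e1 : (A.subgroupOf B).map B.subtype = A := by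
    rw [subgroupOf_map_subtype, inf_eq_left.2 hAB]
  have e2 : (⊤ : Subgroup B).map B.subtype = B := by
    rw [← MonoidHom.range_eq_map, range_subtype]
  constructor
  · intro h
    have := h.map B.subtype_injective
    rwa [e1, e2] at this
  · intro h
    apply ModIn.of_map B.subtype_injective
    rwa [e1, e2]

lemma ModIn.comap {G H : Type*} [Group G] [Group H] {f : G →* H}
    (hf : Function.Surjective f) {A B : Subgroup H} (h : ModIn A B) :
    ModIn (A.comap f) (B.comap f) := by
  constructor
  · rintro X Z hXZ hZ g ⟨hg1, hg2⟩
    have h1 := h.1 (X.map f) (Z.map f) (map_mono hXZ) (map_le_iff_le_comap.2 hZ)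
    have h2 : f g ∈ (X.map f ⊔ A) ⊓ Z.map f := by
      refine ⟨?_, mem_map_of_mem f hg2⟩
      have := mem_map_of_mem f hg1
      rwa [Subgroup.map_sup, map_comap_eq_self_of_surjective hf] at this
    have h3 : X.map f ⊔ (A ⊓ Z.map f) ≤ (X ⊔ (A.comap f ⊓ Z)).map f := by
      rw [Subgroup.map_sup]
      apply sup_le_sup_left
      rintro _ ⟨ha, z, hz, rfl⟩
      exact ⟨z, ⟨ha, hz⟩, rfl⟩
    obtain ⟨w, hw, hwg⟩ := h3 (h1 h2)
    have hwZ : w ∈ Z := (sup_le hXZ inf_le_right : X ⊔ (A.comap f ⊓ Z) ≤ Z) hw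
    have hk : w⁻¹ * g ∈ A.comap f ⊓ Z := by
      refine ⟨?_, Z.mul_mem (Z.inv_mem hwZ) hg2⟩
      have : f (w⁻¹ * g) = 1 := by rw [_root_.map_mul, _root_.map_inv, hwg]; simp
      exact (show f (w⁻¹ * g) ∈ A from this ▸ A.one_mem)
    have := mul_mem hw (mem_sup_right (S := X) hk)
    simpa using this
  · rintro Y Z hY hZ hAZ g ⟨hg1, hg2⟩
    have h1 := h.2 (Y.map f) (Z.map f) (map_le_iff_le_comap.2 hY) (map_le_iff_le_comap.2 hZ)
      (by rw [← map_comap_eq_self_of_surjective hf A]; exact map_mono hAZ)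
    have h2 : f g ∈ (A ⊔ Y.map f) ⊓ Z.map f := by
      refine ⟨?_, mem_map_of_mem f hg2⟩
      have := mem_map_of_mem f hg1
      rwa [Subgroup.map_sup, map_comap_eq_self_of_surjective hf] at this
    have hk : ∀ k, f k = 1 → k ∈ A.comap f := by
      intro k hk
      simp only [mem_comap, hk]; exact A.one_mem
    have h3 : A ⊔ (Y.map f ⊓ Z.map f) ≤ (A.comap f ⊔ (Y ⊓ Z)).map f := by
      rw [Subgroup.map_sup, map_comap_eq_self_of_surjective hf]
      apply sup_le_sup_left
      rintro _ ⟨⟨y, hy, rfl⟩, z, hz, hzy⟩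
      refine ⟨y, ⟨hy, ?_⟩, rfl⟩
      have := mul_mem hz (hAZ (hk (z⁻¹ * y) (by rw [_root_.map_mul, _root_.map_inv, hzy]; simp)))
      simpa using this
    obtain ⟨w, hw, hwg⟩ := h3 (h1 h2)
    have := mul_mem hw (mem_sup_left (T := Y ⊓ Z) (hk (w⁻¹ * g)
      (by rw [_root_.map_mul, _root_.map_inv, hwg]; simp)))
    simpa using this

lemma IsModularSubgroup.comap {G H : Type*} [Group G] [Group H] {f : G →* H}
    (hf : Function.Surjective f) {A : Subgroup H} (h : IsModularSubgroup A) :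
    IsModularSubgroup (A.comap f) := by
  rw [modular_iff_modIn_top] at *
  simpa using h.comap hf

lemma IsModularSubgroup.map {G H : Type*} [Group G] [Group H] {f : G →* H}
    (hf : Function.Surjective f) {A : Subgroup G} (h : IsModularSubgroup A) :
    IsModularSubgroup (A.map f) := by
  rw [modular_iff_modIn_top] at *
  constructor
  · rintro X Z hXZ - 
    have := map_mono (f := f) (h.1 (X.comap f) (Z.comap f) (comap_mono hXZ) le_top)
    rintro g ⟨hg1, hg2⟩
    obtain ⟨g, rfl⟩ := hf g
    rw [← map_comap_eq_self_of_surjective hf X, ← Subgroup.map_sup] at hg1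
    obtain ⟨w, hw, hwg⟩ := hg1
    have h2 := this ⟨w, ⟨hw, by simpa [hwg] using hg2⟩, rfl⟩
    rw [Subgroup.map_sup, map_comap_eq_self_of_surjective hf, hwg] at h2
    refine (sup_le_sup_left ?_ X) h2
    rintro _ ⟨a, ⟨ha, hz⟩, rfl⟩
    exact ⟨⟨a, ha, rfl⟩, hz⟩
  · rintro Y Z - - hAZ
    have := map_mono (f := f) (h.2 (Y.comap f) (Z.comap f) le_top le_top
      (map_le_iff_le_comap.1 hAZ))
    rintro g ⟨hg1, hg2⟩
    rw [← map_comap_eq_self_of_surjective hf Y, ← Subgroup.map_sup] at hg1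
    obtain ⟨w, hw, hwg⟩ := hg1
    have h2 := this ⟨w, ⟨hw, by simpa [hwg] using hg2⟩, rfl⟩
    rwa [Subgroup.map_sup, ← comap_inf, map_comap_eq_self_of_surjective hf, hwg] at h2

lemma IsModularSubgroup.of_map_subtype {G : Type*} [Group G] {K : Subgroup G}
    {A : Subgroup K} (h : IsModularSubgroup (A.map K.subtype)) : IsModularSubgroup A := by
  rw [modular_iff_modIn_top] at *
  apply ModIn.of_map K.subtype_injective
  exact ⟨fun X Z h1 _ => h.1 X Z h1 le_top, fun X Z _ _ h3 => h.2 X Z le_top le_top h3⟩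

lemma IsModularSubgroup.of_normal {G : Type*} [Group G] (A : Subgroup G) [A.Normal] :
    IsModularSubgroup A := by
  rw [modular_iff_modIn_top]
  constructor
  · rintro X Z hXZ - g ⟨hg1, hg2⟩
    obtain ⟨x, hx, a, ha, rfl⟩ := mem_sup_of_normal_right.1 hg1
    refine mul_mem (mem_sup_left hx) (mem_sup_right ⟨ha, ?_⟩)
    have := Z.mul_mem (Z.inv_mem (hXZ hx)) hg2
    simpa using this
  · rintro Y Z - - hAZ g ⟨hg1, hg2⟩
    obtain ⟨a, ha, y, hy, rfl⟩ := mem_sup_of_normal_left.1 hg1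
    refine mul_mem (mem_sup_left ha) (mem_sup_right ⟨hy, ?_⟩)
    have := Z.mul_mem (Z.inv_mem (hAZ ha)) hg2
    simpa using this

lemma IsSubmodular.top {G : Type*} [Group G] : IsSubmodular (⊤ : Subgroup G) :=
  ⟨0, fun _ => ⊤, rfl, rfl, fun k => k.elim0⟩

lemma IsSubmodular.step {G : Type*} [Group G] {A B : Subgroup G} (hAB : A ≤ B)
    (hm : IsModularSubgroup (A.subgroupOf B)) (hB : IsSubmodular B) : IsSubmodular A := by
  obtain ⟨n, C, rfl, h1, h2⟩ := hB
  refine ⟨n + 1, Fin.cons A C, rfl, ?_, ?_⟩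
  · rw [← Fin.succ_last, Fin.cons_succ, h1]
  · intro k
    refine Fin.cases ?_ (fun k => ?_) k
    · exact ⟨hAB, hm⟩
    · rw [← Fin.succ_castSucc, Fin.cons_succ, Fin.cons_succ]
      exact h2 k

lemma IsSubmodular.ind {G : Type*} [Group G] {P : Subgroup G → Prop} (htop : P ⊤)
    (hstep : ∀ A B : Subgroup G, A ≤ B → IsModularSubgroup (A.subgroupOf B) → P B → P A)
    {A : Subgroup G} (hA : IsSubmodular A) : P A := by
  obtain ⟨n, C, rfl, h1, h2⟩ := hA
  have : ∀ k, P (C k) := by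
    intro k
    refine Fin.reverseInduction ?_ ?_ k
    · rw [h1]; exact htop
    · intro i hi
      exact hstep _ _ (h2 i).1 (h2 i).2 hi
  exact this 0

lemma IsSubnormalSub.top {G : Type*} [Group G] : IsSubnormalSub (⊤ : Subgroup G) :=
  ⟨0, fun _ => ⊤, rfl, rfl, fun k => k.elim0⟩

lemma IsSubnormalSub.step {G : Type*} [Group G] {A B : Subgroup G} (hAB : A ≤ B)
    (hm : (A.subgroupOf B).Normal) (hB : IsSubnormalSub B) : IsSubnormalSub A := by
  obtain ⟨n, C, rfl, h1, h2⟩ := hB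
  refine ⟨n + 1, Fin.cons A C, rfl, ?_, ?_⟩
  · rw [← Fin.succ_last, Fin.cons_succ, h1]
  · intro k
    refine Fin.cases ?_ (fun k => ?_) k
    · exact ⟨hAB, hm⟩
    · rw [← Fin.succ_castSucc, Fin.cons_succ, Fin.cons_succ]
      exact h2 k

lemma IsSubnormalSub.ind {G : Type*} [Group G] {P : Subgroup G → Prop} (htop : P ⊤)
    (hstep : ∀ A B : Subgroup G, A ≤ B → (A.subgroupOf B).Normal → P B → P A)
    {A : Subgroup G} (hA : IsSubnormalSub A) : P A := by
  obtain ⟨n, C, rfl, h1, h2⟩ := hA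
  have : ∀ k, P (C k) := by
    intro k
    refine Fin.reverseInduction ?_ ?_ k
    · rw [h1]; exact htop
    · intro i hi
      exact hstep _ _ (h2 i).1 (h2 i).2 hi
  exact this 0

lemma IsSubmodular.map_subtype {G : Type*} [Group G] {K : Subgroup G} (hK : K.Normal)
    {A : Subgroup K} (hA : IsSubmodular A) : IsSubmodular (A.map K.subtype) := by
  refine IsSubmodular.ind (P := fun A => IsSubmodular (A.map K.subtype)) ?_ ?_ hA
  · rw [← MonoidHom.range_eq_map, range_subtype]
    have := IsModularSubgroup.of_normal (K.subgroupOf ⊤)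
    exact IsSubmodular.step le_top this IsSubmodular.top
  · intro A B hAB hm hB
    refine IsSubmodular.step (map_mono hAB) ?_ hB
    rw [modular_subgroupOf_iff (map_mono hAB)]
    exact ((modular_subgroupOf_iff hAB).1 hm).map K.subtype_injective

lemma IsSubmodular.comap {G H : Type*} [Group G] [Group H] {f : G →* H}
    (hf : Function.Surjective f) {A : Subgroup H} (hA : IsSubmodular A) :
    IsSubmodular (A.comap f) := by
  refine IsSubmodular.ind (P := fun A => IsSubmodular (A.comap f)) ?_ ?_ hA
  · rw [comap_top]; exact IsSubmodular.top
  · intro A B hAB hm hB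
    refine IsSubmodular.step (comap_mono hAB) ?_ hB
    rw [modular_subgroupOf_iff (comap_mono hAB)]
    exact ((modular_subgroupOf_iff hAB).1 hm).comap hf

lemma IsSubnormalSub.map_subtype {G : Type*} [Group G] {K : Subgroup G} (hK : K.Normal)
    {A : Subgroup K} (hA : IsSubnormalSub A) : IsSubnormalSub (A.map K.subtype) := by
  refine IsSubnormalSub.ind (P := fun A => IsSubnormalSub (A.map K.subtype)) ?_ ?_ hA
  · rw [← MonoidHom.range_eq_map, range_subtype]
    exact IsSubnormalSub.step le_top inferInstance IsSubnormalSub.top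
  · intro A B hAB hm hB
    refine IsSubnormalSub.step (map_mono hAB) ?_ hB
    rw [normal_subgroupOf_iff hAB] at hm
    rw [normal_subgroupOf_iff (map_mono hAB)]
    rintro _ _ ⟨a, ha, rfl⟩ ⟨b, hb, rfl⟩
    exact ⟨b * a * b⁻¹, hm a b ha hb, by simp⟩

lemma IsSubnormalSub.comap {G H : Type*} [Group G] [Group H] (f : G →* H)
    {A : Subgroup H} (hA : IsSubnormalSub A) :
    IsSubnormalSub (A.comap f) := by
  refine IsSubnormalSub.ind (P := fun A => IsSubnormalSub (A.comap f)) ?_ ?_ hA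
  · rw [comap_top]; exact IsSubnormalSub.top
  · intro A B hAB hm hB
    refine IsSubnormalSub.step (comap_mono hAB) ?_ hB
    rw [normal_subgroupOf_iff hAB] at hm
    rw [normal_subgroupOf_iff (comap_mono hAB)]
    intro a b ha hb
    simpa using hm (f a) (f b) ha hb

/-- The PT condition passes to normal subgroups. -/
lemma PT_normal {G : Type*} [Group G]
    (hPT : ∀ A : Subgroup G, IsSubnormalSub A → IsQuasinormal A)
    {K : Subgroup G} (hK : K.Normal) :
    ∀ A : Subgroup K, IsSubnormalSub A → IsQuasinormal A := by
  intro A hA B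
  have h := hPT _ (hA.map_subtype hK) (B.map K.subtype)
  unfold Permutes at *
  have hinj : Function.Injective (Set.image K.subtype) :=
    Set.image_injective.2 K.subtype_injective
  apply hinj
  rw [Set.image_mul, Set.image_mul]
  simpa only [coe_map] using h

/-- The PT condition passes to quotients. -/
lemma PT_quot {G H : Type*} [Group G] [Group H] {f : G →* H} (hf : Function.Surjective f)
    (hPT : ∀ A : Subgroup G, IsSubnormalSub A → IsQuasinormal A) :
    ∀ A : Subgroup H, IsSubnormalSub A → IsQuasinormal A := by
  intro A hA B
  have h := hPT _ (hA.comap f) (B.comap f)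
  unfold Permutes at *
  have h2 := congrArg (Set.image f) h
  rw [Set.image_mul, Set.image_mul] at h2
  simpa only [coe_comap, Set.image_preimage_eq _ hf] using h2

lemma card_mul_relIndex_aux {G : Type*} [Group G] {X Z : Subgroup G} (h : X ≤ Z) :
    Nat.card X * X.relIndex Z = Nat.card Z := by
  rw [← relIndex_bot_left, ← relIndex_bot_left]
  exact relIndex_mul_relIndex _ _ _ bot_le h

lemma arith_aux {a d c p q : ℕ} (hp : p.Prime) (hq : q.Prime) (h : p * q = a * d * c)
    (ha : a ≠ 1) (hc : c ≠ 1) : d = 1 := by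
  by_contra hd
  have key : ∀ x y z : ℕ, p ∣ x → p * q = x * y * z → y ≠ 1 → z ≠ 1 → False := by
    rintro x y z ⟨t, rfl⟩ h hy hz
    have h1 : q = t * y * z := by
      apply Nat.eq_of_mul_eq_mul_left hp.pos
      rw [h]; ring
    rw [h1] at hq
    rcases Nat.prime_mul_iff.1 hq with ⟨_, h2⟩ | ⟨_, h2⟩
    · exact hz h2
    · exact hy (mul_eq_one.1 h2).2
  have hdvd : p ∣ a * d * c := ⟨q, h.symm⟩
  rcases (Nat.Prime.dvd_mul hp).1 hdvd with h1 | h1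
  · rcases (Nat.Prime.dvd_mul hp).1 h1 with h2 | h2
    · exact key a d c h2 h hd hc
    · exact key d a c h2 (by rw [h]; ring) ha hc
  · exact key c a d h1 (by rw [h]; ring) ha hd

/-- A subgroup of prime index and of order `1` or a prime is modular. -/
lemma modular_of_small {T : Type*} [Group T] [Finite T] (A : Subgroup T)
    (hi : A.index.Prime) (hA : Nat.card A = 1 ∨ (Nat.card A).Prime) :
    IsModularSubgroup A := by
  have hmax : ∀ B : Subgroup T, A ≤ B → B = A ∨ B = ⊤ := by
    intro B hAB
    have h1 := relIndex_mul_index hAB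
    rw [← h1] at hi
    rcases Nat.prime_mul_iff.1 hi with ⟨_, h2⟩ | ⟨_, h2⟩
    · right; exact index_eq_one.1 h2
    · left; exact le_antisymm (relIndex_eq_one.1 h2) hAB
  have hmin : ∀ Z : Subgroup T, A ⊓ Z = ⊥ ∨ A ≤ Z := by
    intro Z
    have h1 : Nat.card (A ⊓ Z : Subgroup T) ∣ Nat.card A := card_dvd_of_le inf_le_left
    have h2 : Nat.card (A ⊓ Z : Subgroup T) = 1 ∨ Nat.card (A ⊓ Z : Subgroup T) = Nat.card A := by
      rcases hA with h | h
      · left; rw [h] at h1; exact Nat.dvd_one.1 h1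
      · exact (Nat.dvd_prime h).1 h1
    rcases h2 with h2 | h2
    · left; exact card_eq_one.1 h2
    · right
      have := eq_of_le_of_card_ge (inf_le_left : A ⊓ Z ≤ A) h2.ge
      exact inf_eq_left.1 this
  rw [modular_iff_modIn_top]
  constructor
  · rintro X Z hXZ -
    rcases hmin Z with hZ | hZ
    · rcases hmax (X ⊔ A) le_sup_right with h1 | h1
      · rw [h1]; exact le_sup_right
      · rw [h1, hZ]
        simp only [top_inf_eq, bot_le, sup_of_le_left]
        by_cases hX1 : Nat.card X = 1
        · rw [card_eq_one] at hX1
          subst hX1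
          rw [bot_sup_eq] at h1
          rw [h1] at hi
          simp at hi
          exact absurd hi Nat.not_prime_one
        · have hcT : Nat.card A * A.index = Nat.card X * X.relIndex Z * Z.index := by
            rw [card_mul_index, card_mul_relIndex_aux hXZ, card_mul_index]
          rcases hA with hA | hA
          · rw [hA, one_mul] at hcT
            rw [hcT, mul_assoc] at hi
            rcases Nat.prime_mul_iff.1 hi with ⟨_, h2⟩ | ⟨_, h2⟩
            · exact relIndex_eq_one.1 (mul_eq_one.1 h2).1
            · exact absurd h2 hX1
          · refine relIndex_eq_one.1 (arith_aux hA hi hcT hX1 ?_)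
            intro h
            rw [index_eq_one] at h
            subst h
            rw [inf_top_eq] at hZ
            rw [hZ] at hA
            simp at hA
            exact absurd hA Nat.not_prime_one
    · exact inf_le_left.trans (sup_le_sup_left (le_inf le_rfl hZ) X)
  · rintro Y Z - - hAZ
    rcases hmax Z hAZ with h | h
    · rw [h]; exact inf_le_right.trans le_sup_left
    · rw [h]; simp

/-- Same with a normal subgroup of `T` below `A`. -/
lemma modular_of_core {T : Type*} [Group T] [Finite T] (A C : Subgroup T) [hC : C.Normal]
    (hCA : C ≤ A)
    (hi : A.index.Prime) (hA : C.relIndex A = 1 ∨ (C.relIndex A).Prime) :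
    IsModularSubgroup A := by
  have hs := QuotientGroup.mk'_surjective C
  have e : (A.map (QuotientGroup.mk' C)).comap (QuotientGroup.mk' C) = A := by
    rw [comap_map_eq, QuotientGroup.ker_mk', sup_eq_left.2 hCA]
  rw [← e]
  apply IsModularSubgroup.comap hs
  apply modular_of_small
  · rwa [← index_comap_of_surjective _ hs, e]
  · have : Nat.card (A.map (QuotientGroup.mk' C)) = C.relIndex A := by
      have h1 := relIndex_ker (QuotientGroup.mk' C) (K := A)
      rw [QuotientGroup.ker_mk'] at h1
      rw [h1]
    rwa [this]

/-- A nontrivial finite soluble PT-group has a normal subgroup of prime order. -/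
lemma exists_normal_prime {G : Type*} [Group G] [Finite G] [Nontrivial G]
    (hsol : Group.IsSolvable G)
    (hPT : ∀ A : Subgroup G, IsSubnormalSub A → IsQuasinormal A) :
    ∃ N : Subgroup G, N.Normal ∧ (Nat.card N).Prime := by
  classical
  -- a nontrivial abelian normal subgroup
  obtain ⟨W, hWn, hWb, hWc⟩ : ∃ W : Subgroup G, W.Normal ∧ W ≠ ⊥ ∧
      ∀ a ∈ W, ∀ b ∈ W, a * b = b * a := by
    have hex := hsol.solvable
    have hn := Nat.find_spec hex
    have hm : ∀ m, m < Nat.find hex → derivedSeries G m ≠ ⊥ := fun m h => Nat.find_min hex h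
    generalize Nat.find hex = n at hn hm
    cases n with
    | zero => simp at hn
    | succ m =>
      refine ⟨derivedSeries G m, inferInstance, hm m (Nat.lt_succ_self m), ?_⟩
      rw [derivedSeries_succ, commutator_eq_bot_iff_le_centralizer] at hn
      intro a ha b hb
      exact (mem_centralizer_iff.1 (hn hb) a ha)
  -- q
  have hcW : Nat.card W ≠ 1 := fun h => hWb (card_eq_one.1 h)
  obtain ⟨q, hq, hqW⟩ := Nat.exists_prime_and_dvd hcW
  have : Fact q.Prime := ⟨hq⟩
  obtain ⟨w, hw⟩ := exists_prime_orderOf_dvd_card' (G := W) q hqW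
  let V : Subgroup G :=
    { carrier := {x | x ∈ W ∧ x ^ q = 1}
      one_mem' := ⟨W.one_mem, one_pow q⟩
      mul_mem' := by
        rintro a b ⟨ha, ha'⟩ ⟨hb, hb'⟩
        refine ⟨W.mul_mem ha hb, ?_⟩
        have : Commute a b := hWc a ha b hb
        rw [this.mul_pow, ha', hb', one_mul]
      inv_mem' := by
        rintro a ⟨ha, ha'⟩
        exact ⟨W.inv_mem ha, by rw [inv_pow, ha', inv_one]⟩ }
  have hV : ∀ x, x ∈ V ↔ x ∈ W ∧ x ^ q = 1 := fun x => Iff.rfl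
  have hVn : V.Normal := by
    constructor
    intro x hx g
    refine ⟨hWn.conj_mem x hx.1 g, ?_⟩
    rw [conj_pow, hx.2]; simp
  have hwV : (w : G) ∈ V := ⟨w.2, by rw [← hw, ← orderOf_coe]; exact pow_orderOf_eq_one _⟩
  have hqV : q ∣ Nat.card V := by
    rw [← hw, ← orderOf_coe, ← orderOf_mk (w : G) hwV]
    exact orderOf_dvd_natCard _
  obtain ⟨S⟩ : Nonempty (Sylow q G) := inferInstance
  let act : MulAction S V := MulAction.compHom V ((MulAut.conjNormal (H := V)).comp (S : Subgroup G).subtype)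
  have hact : ∀ (s : S) (v : V), ((s • v : V) : G) = s * v * (s : G)⁻¹ := by
    intro s v
    exact MulAut.conjNormal_apply (s : G) v
  obtain ⟨b, hb, hb1⟩ := S.2.exists_fixed_point_of_prime_dvd_card_of_fixed_point (α := V) hqV
    (a := 1) (by
      intro s
      apply Subtype.ext
      rw [hact]; simp)
  have hbS : ∀ s ∈ S, s * (b : G) * s⁻¹ = b := by
    intro s hs
    rw [← hact ⟨s, hs⟩ b, hb ⟨s, hs⟩]
  obtain ⟨b, hbV⟩ := b
  simp only at hbS
  have hb1 : b ≠ 1 := fun h => hb1 (Subtype.ext h.symm)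
  have hob : orderOf b = q := orderOf_eq_prime hbV.2 hb1
  have hsubn : IsSubnormalSub (zpowers b) := by
    refine IsSubnormalSub.step (B := V) (by rw [zpowers_le]; exact hbV) ?_
      (IsSubnormalSub.step (B := ⊤) le_top inferInstance IsSubnormalSub.top)
    rw [normal_subgroupOf_iff (by rw [zpowers_le]; exact hbV)]
    rintro _ v ⟨i, rfl⟩ hv
    have : v * b ^ i = b ^ i * v := hWc v hv.1 _ (W.zpow_mem hbV.1 i)
    simp only [this, mul_inv_cancel_right]
    exact ⟨i, rfl⟩
  have hqn := hPT _ hsubn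
  have hcop : ∀ x : G, (orderOf x).Coprime q → x * b * x⁻¹ ∈ zpowers b := by
    intro x hx
    have h1 := hqn (zpowers x)
    have h2 : x * b ∈ (zpowers b : Set G) * (zpowers x : Set G) := by
      rw [h1]; exact Set.mul_mem_mul (mem_zpowers x) (mem_zpowers b)
    obtain ⟨y, hy, z, hz, hyz⟩ := h2
    have hyz : y * z = x * b := hyz
    have h3 : x * b * x⁻¹ = y * (z * x⁻¹) := by rw [← hyz, mul_assoc]
    have hyV : y ∈ V := (zpowers_le.2 hbV) hy
    have h4 : z * x⁻¹ ∈ V := by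
      have := V.mul_mem (V.inv_mem hyV) (hVn.conj_mem b hbV x)
      rw [h3] at this
      simpa using this
    have h5 : z * x⁻¹ ∈ zpowers x := mul_mem hz (inv_mem (mem_zpowers x))
    have h6 : z * x⁻¹ = 1 := by
      have d1 : orderOf (z * x⁻¹) ∣ q := orderOf_dvd_of_pow_eq_one h4.2
      have d2 : orderOf (z * x⁻¹) ∣ orderOf x := orderOf_dvd_of_mem_zpowers h5
      rw [← orderOf_eq_one_iff]
      exact Nat.eq_one_of_dvd_coprimes hx d2 d1
    rw [h3, h6, mul_one]; exact hy
  have hnorm : ∀ L : Subgroup G, (∀ x ∈ L, x * b * x⁻¹ ∈ zpowers b) →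
      L ≤ normalizer (zpowers b : Set G) := by
    intro L hL
    have h1 : ∀ x ∈ L, ∀ y ∈ zpowers b, x * y * x⁻¹ ∈ zpowers b := by
      rintro x hx _ ⟨i, rfl⟩
      simp only
      rw [← conj_zpow]
      exact zpow_mem (hL x hx) i
    intro x hx
    rw [mem_normalizer_iff]
    intro y
    refine ⟨fun hy => h1 x hx y hy, fun hy => ?_⟩
    have := h1 x⁻¹ (L.inv_mem hx) _ hy
    simpa [mul_assoc] using this
  refine ⟨zpowers b, ?_, by rw [Nat.card_zpowers, hob]; exact hq⟩
  rw [← normalizer_eq_top_iff, ← index_eq_one]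
  by_contra hne
  obtain ⟨r, hr, hrd⟩ := Nat.exists_prime_and_dvd hne
  have : Fact r.Prime := ⟨hr⟩
  by_cases hrq : r = q
  · subst hrq
    have : (S : Subgroup G) ≤ normalizer (zpowers b : Set G) :=
      hnorm S fun s hs => by rw [hbS s hs]; exact mem_zpowers b
    exact S.not_dvd_index (hrd.trans (index_dvd_of_le this))
  · obtain ⟨R⟩ : Nonempty (Sylow r G) := inferInstance
    have : (R : Subgroup G) ≤ normalizer (zpowers b : Set G) := by
      refine hnorm R fun s hs => hcop s ?_
      obtain ⟨k, hk⟩ := (IsPGroup.iff_orderOf.1 R.2) ⟨s, hs⟩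
      rw [orderOf_mk] at hk
      rw [hk]
      exact Nat.Coprime.pow_left k ((Nat.coprime_primes hr hq).2 hrq)
    exact R.not_dvd_index (hrd.trans (index_dvd_of_le this))

/-- The key step: `A` is modular in `A N` for a normal subgroup `N` of prime order. -/
lemma modular_in_sup {G : Type*} [Group G] [Finite G] {p : ℕ} (hp : p.Prime)
    (N : Subgroup G) [hN : N.Normal] (hNc : (Nat.card N).Prime)
    (ih : ∀ K : Subgroup G, K.Normal → K ≠ ⊤ → ∀ B : Subgroup G, B ≤ K → IsPGroup p B →
      IsModularSubgroup B)
    (A : Subgroup G) (hA : IsPGroup p A) :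
    IsModularSubgroup (A.subgroupOf (A ⊔ N)) := by
  have : Fact p.Prime := ⟨hp⟩
  by_cases hNA : N ≤ A
  · rw [sup_eq_left.2 hNA, subgroupOf_self]
    exact IsModularSubgroup.of_normal _
  have hNAb : N ⊓ A = ⊥ := by
    have h1 : Nat.card (N ⊓ A : Subgroup G) ∣ Nat.card N := card_dvd_of_le inf_le_left
    rcases (Nat.dvd_prime hNc).1 h1 with h2 | h2
    · exact card_eq_one.1 h2
    · exact absurd (inf_eq_left.1 (eq_of_le_of_card_ge inf_le_left h2.ge)) hNA
  have hidx : A.relIndex (A ⊔ N) = Nat.card N := by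
    have h1 := card_mul_relIndex_aux (le_sup_left : A ≤ A ⊔ N)
    have h2 := card_mul_relIndex_aux (le_sup_right : N ≤ A ⊔ N)
    rw [relIndex_sup_right, ← inf_relIndex_right, hNAb, relIndex_bot_left, ← h1,
      mul_comm] at h2
    exact (Nat.eq_of_mul_eq_mul_left Nat.card_pos h2).symm
  have : Fact (Nat.card N).Prime := ⟨hNc⟩
  have hcyc : IsCyclic N := isCyclic_of_prime_card rfl
  let φ : G →* (ZMod (Nat.card N))ˣ :=
    (IsCyclic.mulAutMulEquiv N).toMonoidHom.comp MulAut.conjNormal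
  obtain ⟨C, hCdef⟩ : ∃ C, C = φ.ker := ⟨_, rfl⟩
  have hCn : C.Normal := by rw [hCdef]; infer_instance
  have hcomm : commutator G ≤ C := by
    rw [hCdef]; exact Abelianization.commutator_subset_ker φ
  have hCmem : ∀ g, g ∈ C ↔ ∀ n ∈ N, g * n * g⁻¹ = n := by
    intro g
    have e : g ∈ C ↔ MulAut.conjNormal (H := N) g = 1 := by
      rw [hCdef, MonoidHom.mem_ker]
      change (IsCyclic.mulAutMulEquiv N) (MulAut.conjNormal g) = 1 ↔ _
      exact EmbeddingLike.map_eq_one_iff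
    rw [e]
    constructor
    · intro h n hn
      have := MulAut.conjNormal_apply g (⟨n, hn⟩ : N)
      rw [h] at this
      exact this.symm
    · intro h
      ext n
      rw [MulAut.conjNormal_apply, h n n.2]
      rfl
  -- membership in `C` can be tested on a single nontrivial element
  have hCone : ∀ n ∈ N, n ≠ 1 → ∀ g, g * n * g⁻¹ = n → g ∈ C := by
    intro n hn hn1 g hg
    rw [hCmem]
    intro m hm
    have hgen : zpowers (⟨n, hn⟩ : N) = ⊤ :=
      zpowers_eq_top_of_prime_card rfl (fun h => hn1 (congrArg Subtype.val h))
    have : (⟨m, hm⟩ : N) ∈ zpowers (⟨n, hn⟩ : N) := by rw [hgen]; trivial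
    obtain ⟨i, hi⟩ := this
    have hi : n ^ i = m := congrArg Subtype.val hi
    rw [← hi, ← conj_zpow, hg]
  obtain ⟨m, hm⟩ := IsPGroup.iff_card.1 hA
  have hCA : C.relIndex A ∣ p ^ m := by
    rw [← hm]; exact relIndex_dvd_card C A
  obtain ⟨k, hkm, hk⟩ := (Nat.dvd_prime_pow hp).1 hCA
  have hcard : Nat.card (C.subgroupOf A) * p ^ k = p ^ m := by
    rw [← hk, ← hm]; exact card_mul_index (C.subgroupOf A)
  by_cases hk2 : k ≤ 1
  · have hnor : ((C ⊓ A).subgroupOf (A ⊔ N)).Normal := by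
      rw [normal_subgroupOf_iff (inf_le_right.trans le_sup_left)]
      intro c g hc hg
      obtain ⟨a, ha, n, hn, rfl⟩ := mem_sup_of_normal_right.1 hg
      have h1 : n * c * n⁻¹ = c := by
        have := (hCmem c).1 hc.1 n hn
        have h2 : n * c = c * n := by
          rw [mul_inv_eq_iff_eq_mul] at this
          exact this.symm
        rw [h2]; simp
      have h2 : a * n * c * (a * n)⁻¹ = a * c * a⁻¹ := by
        conv_rhs => rw [← h1]
        group
      rw [h2]
      exact ⟨hCn.conj_mem c hc.1 a, A.mul_mem (A.mul_mem ha hc.2) (A.inv_mem ha)⟩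
    refine modular_of_core _ ((C ⊓ A).subgroupOf (A ⊔ N)) ?_ ?_ ?_
    · exact comap_mono inf_le_right
    · change (A.relIndex (A ⊔ N)).Prime
      rw [hidx]; exact hNc
    · rw [relIndex_subgroupOf le_sup_left, inf_relIndex_right, hk]
      interval_cases k
      · left; simp
      · right; simpa using hp
  · exfalso
    push Not at hk2
    have hcc : Nat.card (C.subgroupOf A) = p ^ (m - k) := by
      apply Nat.eq_of_mul_eq_mul_right (pow_pos hp.pos k)
      rw [hcard, ← pow_add, Nat.sub_add_cancel hkm]
    obtain ⟨B', hB'c, hB'⟩ := Sylow.exists_subgroup_card_pow_succ (p := p) (n := m - k)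
      (by rw [hm]; exact pow_dvd_pow p (by omega)) hcc
    obtain ⟨B, hBdef⟩ : ∃ B, B = B'.map A.subtype := ⟨_, rfl⟩
    have hBA : B ≤ A := by rw [hBdef]; exact map_subtype_le B'
    have hBc : Nat.card B = p ^ (m - k + 1) := by
      rw [hBdef, ← hB'c]
      exact (Nat.card_congr (B'.equivMapOfInjective _ A.subtype_injective).toEquiv).symm
    have hCB : C ⊓ A ≤ B := by
      rw [hBdef]
      rintro x ⟨hx, hxA⟩
      exact ⟨⟨x, hxA⟩, hB' hx, rfl⟩
    have hAB : ¬ A ≤ B := by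
      intro h
      have h1 : B = A := le_antisymm hBA h
      rw [h1, hm] at hBc
      have := Nat.pow_right_injective hp.two_le hBc
      omega
    have hBC : ¬ B ≤ C := by
      intro h
      have h1 : B' ≤ C.subgroupOf A := by
        intro x hx
        refine h ?_
        rw [hBdef]
        exact ⟨x, hx, rfl⟩
      have h2 := card_dvd_of_le h1
      rw [hB'c, hcc, Nat.pow_dvd_pow_iff_le_right hp.one_lt] at h2
      omega
    have hBp : IsPGroup p B := hA.to_le hBA
    have hBm : IsModularSubgroup B := by
      refine ih (B ⊔ C) (Subgroup.Normal.of_commutator_le _ (hcomm.trans le_sup_right)) ?_ B le_sup_left hBp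
      intro htop
      apply hAB
      intro a ha
      have : a ∈ B ⊔ C := by rw [htop]; trivial
      obtain ⟨b, hb, c, hc, rfl⟩ := mem_sup_of_normal_right.1 this
      refine B.mul_mem hb (hCB ⟨hc, ?_⟩)
      have := A.mul_mem (A.inv_mem (hBA hb)) ha
      simpa using this
    obtain ⟨n, hn, hn1⟩ : ∃ n ∈ N, n ≠ 1 := by
      have : N ≠ ⊥ := fun h => by
        rw [h] at hNc; simp at hNc; exact absurd hNc Nat.not_prime_one
      exact (N.bot_or_exists_ne_one).resolve_left this
    obtain ⟨Y, hY⟩ : ∃ Y, Y = A.map (MulAut.conj n).toMonoidHom := ⟨_, rfl⟩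
    have hYA : Y ⊓ A ≤ B := by
      rw [hY]
      rintro x ⟨⟨a, ha, rfl⟩, hx⟩
      have e : (MulAut.conj n).toMonoidHom a = n * a * n⁻¹ := rfl
      rw [e] at hx ⊢
      have h1 : n * a * n⁻¹ * a⁻¹ ∈ N ⊓ A := by
        refine ⟨?_, A.mul_mem hx (A.inv_mem ha)⟩
        have := N.mul_mem hn (hN.conj_mem _ (N.inv_mem hn) a)
        simpa [mul_assoc] using this
      rw [hNAb, mem_bot] at h1
      have h2 : n * a * n⁻¹ = a := by
        rwa [mul_inv_eq_one] at h1
      rw [h2]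
      refine hCB ⟨hCone n hn hn1 a ?_, ha⟩
      rw [mul_inv_eq_iff_eq_mul] at h2
      rw [← h2]; simp
    obtain ⟨b, hb, hbC⟩ := SetLike.not_le_iff_exists.1 hBC
    have hcom : n * b * n⁻¹ * b⁻¹ ∈ B ⊔ Y := by
      refine mul_mem (mem_sup_right ?_) (mem_sup_left (B.inv_mem hb))
      rw [hY]
      exact ⟨b, hBA hb, rfl⟩
    have hcomN : n * b * n⁻¹ * b⁻¹ ∈ N := by
      have := N.mul_mem hn (hN.conj_mem _ (N.inv_mem hn) b)
      simpa [mul_assoc] using this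
    have hcom1 : n * b * n⁻¹ * b⁻¹ ≠ 1 := by
      intro h1
      apply hbC
      apply hCone n hn hn1
      have h2 : n * b * n⁻¹ = b := by
        rwa [mul_inv_eq_one] at h1
      rw [mul_inv_eq_iff_eq_mul] at h2
      rw [← h2]; simp
    have hnBY : n ∈ B ⊔ Y := by
      have hgen : zpowers (⟨_, hcomN⟩ : N) = ⊤ :=
        zpowers_eq_top_of_prime_card rfl (fun h => hcom1 (congrArg Subtype.val h))
      have : (⟨n, hn⟩ : N) ∈ zpowers (⟨_, hcomN⟩ : N) := by rw [hgen]; trivial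
      obtain ⟨i, hi⟩ := this
      have hi : (n * b * n⁻¹ * b⁻¹) ^ i = n := congrArg Subtype.val hi
      rw [← hi]
      exact zpow_mem hcom i
    have hABY : A ≤ B ⊔ Y := by
      intro a ha
      have h1 : n * a * n⁻¹ ∈ B ⊔ Y := mem_sup_right (by rw [hY]; exact ⟨a, ha, rfl⟩)
      have h2 := mul_mem (mul_mem (inv_mem hnBY) h1) hnBY
      simpa [mul_assoc] using h2
    have hfin := hBm.2 Y A hBA
    apply hAB
    calc A ≤ (B ⊔ Y) ⊓ A := le_inf hABY le_rfl
      _ = B ⊔ (Y ⊓ A) := hfin.symm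
      _ ≤ B := sup_le le_rfl hYA

lemma main_aux (p : ℕ) (hp : p.Prime) (n : ℕ) : ∀ (G : Type*) [Group G] [Finite G],
    Nat.card G = n → Group.IsSolvable G →
    (∀ A : Subgroup G, IsSubnormalSub A → IsQuasinormal A) →
    (∀ A : Subgroup G, IsPGroup p ↥A → IsSubmodular A → IsModularSubgroup A) →
    ∀ A : Subgroup G, IsPGroup p ↥A → IsModularSubgroup A := by
  have : Fact p.Prime := ⟨hp⟩
  induction n using Nat.strong_induction_on with
  | _ n IH =>
  intro G _ _ hn hsol hPT h A hA
  rcases subsingleton_or_nontrivial G with hG | hG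
  · have : A = ⊤ := Subsingleton.elim _ _
    rw [this]
    exact IsModularSubgroup.of_normal _
  obtain ⟨N, hN, hNc⟩ := exists_normal_prime hsol hPT
  have ih : ∀ K : Subgroup G, K.Normal → K ≠ ⊤ → ∀ B : Subgroup G, B ≤ K → IsPGroup p B →
      IsModularSubgroup B := by
    intro K hK hKt B hBK hB
    have hlt : Nat.card K < n := by
      rw [← hn]
      exact lt_of_le_of_ne (card_le_card_group K) (fun h => hKt (eq_top_of_card_eq K h))
    have h1 := IH _ hlt K rfl inferInstance (PT_normal hPT hK) (fun E hE hE' => by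
      apply IsModularSubgroup.of_map_subtype
      exact h _ (hE.map K.subtype) (hE'.map_subtype hK)) (B.subgroupOf K)
      (hB.comap_of_injective K.subtype K.subtype_injective)
    refine h B hB (IsSubmodular.step hBK h1 ?_)
    exact IsSubmodular.step le_top (IsModularSubgroup.of_normal _) IsSubmodular.top
  have key := modular_in_sup hp N hNc ih
  have hs := QuotientGroup.mk'_surjective N
  have hlt : Nat.card (G ⧸ N) < n := by
    rw [← hn, card_eq_card_quotient_mul_card_subgroup N]
    exact lt_mul_of_one_lt_right Nat.card_pos hNc.one_lt
  have hcm : ∀ E : Subgroup G, (E.map (QuotientGroup.mk' N)).comap (QuotientGroup.mk' N) =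
      E ⊔ N := by
    intro E
    rw [comap_map_eq, QuotientGroup.ker_mk']
  have hquot := IH _ hlt (G ⧸ N) rfl inferInstance (PT_quot hs hPT) (by
    intro D hD hD'
    obtain ⟨E, hE⟩ : ∃ E, E = D.comap (QuotientGroup.mk' N) := ⟨_, rfl⟩
    have hEs : IsSubmodular E := by rw [hE]; exact hD'.comap hs
    have hNE : N ≤ E := by
      rw [hE]
      intro x hx
      have : QuotientGroup.mk' N x = 1 := (QuotientGroup.eq_one_iff x).2 hx
      rw [mem_comap, this]; exact D.one_mem
    have hED : E.map (QuotientGroup.mk' N) = D := by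
      rw [hE, map_comap_eq_self_of_surjective hs]
    obtain ⟨S⟩ : Nonempty (Sylow p E) := inferInstance
    obtain ⟨P, hP⟩ : ∃ P, P = (S : Subgroup E).map E.subtype := ⟨_, rfl⟩
    have hPp : IsPGroup p P := by rw [hP]; exact S.2.map _
    have hPE : P ≤ E := by rw [hP]; exact map_subtype_le _
    have hPS : P.subgroupOf E = S := by
      rw [hP]; exact comap_map_eq_self_of_injective E.subtype_injective _
    have hPN : P ⊔ N = E := by
      refine le_antisymm (sup_le hPE hNE) ?_
      rw [← relIndex_eq_one]
      have d1 : (P ⊔ N).relIndex E ∣ P.relIndex E := relIndex_dvd_of_le_left E le_sup_left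
      have d2 : (P ⊔ N).relIndex E ∣ N.relIndex E := relIndex_dvd_of_le_left E le_sup_right
      have e2 : N.relIndex E = Nat.card D := by
        have h1 := relIndex_ker (QuotientGroup.mk' N) (K := E)
        rwa [QuotientGroup.ker_mk', hED] at h1
      obtain ⟨m, hm⟩ := IsPGroup.iff_card.1 hD
      rw [e2, hm] at d2
      have e1 : ¬ p ∣ P.relIndex E := by
        have := S.not_dvd_index
        rwa [← hPS] at this
      obtain ⟨k, -, hk⟩ := (Nat.dvd_prime_pow hp).1 d2
      rw [hk] at d1 ⊢
      rcases Nat.eq_zero_or_pos k with h0 | h0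
      · rw [h0, pow_zero]
      · exact absurd ((dvd_pow_self p h0.ne').trans d1) e1
    have hPm : IsModularSubgroup P := by
      refine h P hPp (IsSubmodular.step le_sup_left (key P hPp) ?_)
      rw [hPN]; exact hEs
    have := hPm.map hs
    have e : P.map (QuotientGroup.mk' N) = D := by
      rw [← hED, ← hPN, Subgroup.map_sup, QuotientGroup.map_mk'_self, sup_bot_eq]
    rwa [e] at this) (A.map (QuotientGroup.mk' N)) (hA.map _)
  have hAN : IsModularSubgroup (A ⊔ N) := by
    rw [← hcm]; exact hquot.comap hs
  refine h A hA (IsSubmodular.step le_sup_left (key A hA) ?_)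
  refine IsSubmodular.step le_top ?_ IsSubmodular.top
  rw [modular_subgroupOf_iff le_top, ← modular_iff_modIn_top]
  exact hAN

end Helpers

/-- Let `G` be a finite soluble PT-group (every subnormal subgroup is quasinormal)
and `p` a prime. If every submodular `p`-subgroup of `G` is modular in `G`, then
every `p`-subgroup of `G` is modular in `G`. -/
theorem statement_18 {G : Type*} [Group G] [Finite G]
    (hsol : IsSolvable G)
    (hPT : ∀ A : Subgroup G, IsSubnormalSub A → IsQuasinormal A)
    (p : ℕ) (hp : p.Prime)
    (h : ∀ A : Subgroup G, IsPGroup p ↥A → IsSubmodular A → IsModularSubgroup A) :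
    ∀ A : Subgroup G, IsPGroup p ↥A → IsModularSubgroup A :=
  main_aux p hp _ G rfl hsol hPT h
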